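/- Let q ∈ ℂ with 0 < |q| < 1, let s ∈ ℂ be a square root of q (s² = q), and let ζ ∈ ℂ be a primitive 12th root of unity. Then the double series ∑_{j=1}^{11} ∑_{n∈ℤ} (s^j ζ^j q^n)/(1 − s^j ζ^j q^n)² converges absolutely (all denominators being nonzero), and −22·Ê₂(q) + ∑_{j=1}^{11} ∑_{n∈ℤ} (s^j ζ^j q^n)/(1 − s^j ζ^j q^n)² = 24·(Ê₂⁽³⁾(q) − 3·Ê₂⁽⁶⁾(q) + Ê₂⁽¹²⁾(q)), where Ê₂(q) = −1/24 + ∑_{m=1}^∞ σ₁(m) q^m and Ê₂⁽ᵈ⁾(q) = Ê₂(q) − d·Ê₂(q^d). (This is the q-expansion identity for the weight-2 form A_{β₄₈} attached to the matrix β₄₈ = [[−6,1],[−48,6]] inducing the hyperelliptic involution of X₀(48), evaluated on the Tate curve: the double sum runs over the 11 nonidentity elements s^jζ^j of the order-12 cyclic subgroup of ℂ^×/q^ℤ generated by sζ.) -/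

import Mathlib

/-- The normalized Eisenstein series of weight 2:
`Ê₂(q) = −1/24 + ∑_{m≥1} σ₁(m) q^m`, where `σ₁(m)` is the sum of the positive
divisors of `m`. -/
noncomputable def E2 (q : ℂ) : ℂ :=
  -1 / 24 + ∑' m : ℕ, (∑ d ∈ (m + 1).divisors, (d : ℂ)) * q ^ (m + 1)

/-- `Ê₂⁽ᵈ⁾(q) = Ê₂(q) − d·Ê₂(q^d)`. -/
noncomputable def E2d (d : ℕ) (q : ℂ) : ℂ := E2 q - d * E2 (q ^ d)

open Filter Asymptotics Topology

noncomputable def lamb (x : ℂ) : ℂ := x / (1 - x) ^ 2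

lemma lamb_inv (x : ℂ) : lamb x⁻¹ = lamb x := by
  unfold lamb
  by_cases h : x = 0
  · simp [h]
  by_cases h1 : x = 1
  · simp [h1]
  have : 1 - x ≠ 0 := sub_ne_zero.2 (Ne.symm h1)
  have h3 : 1 - x⁻¹ = -(1 - x) / x := by field_simp; ring
  rw [h3]
  field_simp

lemma summable_lamb_nat (q x : ℂ) (hq : ‖q‖ < 1) : Summable fun n : ℕ => lamb (x * q ^ n) := by
  apply summable_of_isBigO_nat (summable_geometric_of_lt_one (norm_nonneg q) hq)
  have ht : Tendsto (fun n : ℕ => x * q ^ n) atTop (𝓝 0) := by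
    simpa using (tendsto_pow_atTop_nhds_zero_of_norm_lt_one hq).const_mul x
  have h2 : Tendsto (fun n : ℕ => x / (1 - x * q ^ n) ^ 2) atTop (𝓝 (x / (1 - 0) ^ 2)) :=
    Tendsto.div tendsto_const_nhds ((tendsto_const_nhds.sub ht).pow 2) (by simp)
  have h3 := h2.isBigO_one ℝ
  have h4 : (fun n : ℕ => q ^ n) =O[atTop] (fun n : ℕ => ‖q‖ ^ n) := by
    apply IsBigO.of_bound 1
    simp
  have := h3.mul h4
  refine this.congr ?_ ?_
  · intro n; unfold lamb; ring
  · intro n; simp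

lemma summable_lamb_int (q x : ℂ) (hq : ‖q‖ < 1) :
    Summable fun n : ℤ => lamb (x * q ^ n) := by
  apply Summable.of_nat_of_neg
  · simpa using summable_lamb_nat q x hq
  · have := summable_lamb_nat q x⁻¹ hq
    refine this.congr fun n => ?_
    rw [← lamb_inv]; congr 1; simp [mul_comm]

lemma lamb_two (x : ℂ) (h : x ^ 2 ≠ 1) : lamb x + lamb (-x) = 4 * lamb (x ^ 2) := by
  unfold lamb
  have h1 : 1 - x ≠ 0 := fun h' => h (by rw [← sub_eq_zero.1 h']; simp)
  have h2 : 1 - -x ≠ 0 := fun h' => h (by linear_combination (x-1) * h')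
  have h3 : 1 - x ^ 2 = (1 - x) * (1 - -x) := by ring
  rw [h3]
  field_simp
  ring

lemma lamb_three (c x : ℂ) (hc : c ^ 2 + c + 1 = 0) (h : x ^ 3 ≠ 1) :
    lamb x + lamb (c * x) + lamb (c ^ 2 * x) = 9 * lamb (x ^ 3) := by
  unfold lamb
  have h3 : 1 - x ^ 3 = (1 - x) * (1 - c * x) * (1 - c ^ 2 * x) := by
    linear_combination (x + (c - 1) * x ^ 3 - c * x ^ 2) * hc
  have h0 : 1 - x ^ 3 ≠ 0 := sub_ne_zero.2 (Ne.symm h)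
  rw [h3] at h0
  have h1 : 1 - x ≠ 0 := fun h' => h0 (by rw [h']; ring)
  have h2 : 1 - c * x ≠ 0 := fun h' => h0 (by rw [h']; ring)
  have h4 : 1 - c ^ 2 * x ≠ 0 := fun h' => h0 (by rw [h']; ring)
  rw [h3]
  rw [mul_comm c x] at h2 ⊢
  rw [mul_comm (c ^ 2) x] at h4 ⊢
  field_simp
  grind

lemma lamb_six (w x : ℂ) (hw : w ^ 2 - w + 1 = 0) (h : x ^ 6 ≠ 1) :
    lamb x + lamb (w * x) + lamb (w ^ 2 * x) + lamb (w ^ 3 * x) + lamb (w ^ 4 * x)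
      + lamb (w ^ 5 * x) = 36 * lamb (x ^ 6) := by
  have w3 : w ^ 3 = -1 := by linear_combination (w + 1) * hw
  have a1 := lamb_two x (fun h' => h (by linear_combination (x ^ 4 + x ^ 2 + 1) * h'))
  have hw6 : w ^ 6 = 1 := by linear_combination (w ^ 3 - 1) * w3
  have a2 := lamb_two (w * x) (fun h' => h (by
    have : (w * x) ^ 6 = 1 := by rw [show (w * x) ^ 6 = ((w * x) ^ 2) ^ 3 by ring, h']; simp
    rw [mul_pow, hw6, one_mul] at this; exact this))
  have a3 := lamb_two (w ^ 2 * x) (fun h' => h (by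
    have : (w ^ 2 * x) ^ 6 = 1 := by
      rw [show (w ^ 2 * x) ^ 6 = ((w ^ 2 * x) ^ 2) ^ 3 by ring, h']; simp
    rw [mul_pow, ← pow_mul, mul_comm 2 6, pow_mul, hw6, one_pow, one_mul] at this; exact this))
  have a4 := lamb_three (w ^ 2) (x ^ 2) (by linear_combination (w ^ 2 + w + 1) * hw)
    (by rw [← pow_mul]; exact h)
  rw [← pow_mul x] at a4
  rw [show w ^ 3 * x = -x by rw [w3]; ring,
    show w ^ 4 * x = -(w * x) by linear_combination w * x * w3,
    show w ^ 5 * x = -(w ^ 2 * x) by linear_combination w ^ 2 * x * w3]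
  rw [mul_pow] at a2 a3
  linear_combination a1 + a2 + a3 + 4 * a4

lemma lamb_six_one (w : ℂ) (hw : w ^ 2 - w + 1 = 0) :
    lamb w + lamb (w ^ 2) + lamb (w ^ 3) + lamb (w ^ 4) + lamb (w ^ 5) = - 35 / 12 := by
  have w3 : w ^ 3 = -1 := by linear_combination (w + 1) * hw
  have w0 : w ≠ 0 := by rintro rfl; simp at hw
  have key : ∀ y a : ℂ, y ≠ 0 → a ≠ 0 → (1 - y) ^ 2 = a * y → lamb y = 1 / a := by
    intro y a hy ha h
    unfold lamb; rw [h]; field_simp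
  rw [key w (-1) w0 (by norm_num) (by linear_combination hw),
    key (w ^ 2) (-3) (by positivity) (by norm_num) (by linear_combination (w ^ 2 + w + 1) * hw),
    key (w ^ 3) (-4) (by positivity) (by norm_num) (by rw [w3]; norm_num),
    key (w ^ 4) (-3) (by positivity) (by norm_num)
      (by linear_combination (w ^ 5) * w3 - w ^ 2 * w3 + w * w3 + hw),
    key (w ^ 5) (-1) (by positivity) (by norm_num)
      (by linear_combination (w ^ 7) * w3 - w ^ 4 * w3 - w ^ 2 * w3 + w * w3 + hw)]
  norm_num

noncomputable def lambA (q : ℂ) : ℂ := ∑' n : ℕ, lamb (q ^ (n + 1))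

lemma summable_lambA (q : ℂ) (hq : ‖q‖ < 1) : Summable fun n : ℕ => lamb (q ^ (n + 1)) := by
  have := summable_lamb_nat q q hq
  exact this.congr fun n => by rw [pow_succ']

lemma lamb_eq_tsum (x : ℂ) (hx : ‖x‖ < 1) : lamb x = ∑' c : ℕ+, (c : ℂ) * x ^ (c : ℕ) := by
  have h := tsum_coe_mul_geometric_of_norm_lt_one hx
  have hs : Summable fun n : ℕ => (n : ℂ) * x ^ n := by
    simpa using! summable_pow_mul_geometric_of_norm_lt_one 1 hx
  unfold lamb
  rw [← h, tsum_pnat_eq_tsum_succ (f := fun n : ℕ => (n : ℂ) * x ^ n), hs.tsum_eq_zero_add]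
  simp

lemma E2_eq (q : ℂ) (hq : ‖q‖ < 1) : E2 q = -1 / 24 + lambA q := by
  unfold E2 lambA
  congr 1
  have h := tsum_prod_pow_eq_tsum_sigma 1 hq
  rw [← tsum_pnat_eq_tsum_succ (f := fun n : ℕ => lamb (q ^ n)),
    ← tsum_pnat_eq_tsum_succ (f := fun n : ℕ => (∑ d ∈ n.divisors, (d : ℂ)) * q ^ n)]
  trans (∑' e : ℕ+, (ArithmeticFunction.sigma 1 e : ℂ) * q ^ (e : ℕ))
  · simp [ArithmeticFunction.sigma_one_apply]
  rw [← h]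
  refine tsum_congr fun d => ?_
  rw [lamb_eq_tsum]
  · simp [pow_mul]
  · rw [norm_pow]; exact pow_lt_one₀ (norm_nonneg _) hq d.ne_zero

lemma summable_odd (q : ℂ) (hq : ‖q‖ < 1) : Summable fun n : ℕ => lamb (q ^ (2 * n + 1)) := by
  have := summable_lamb_nat (q ^ 2) q (by
    rw [norm_pow]; exact pow_lt_one₀ (norm_nonneg _) hq two_ne_zero)
  exact this.congr fun n => by rw [pow_succ' q (2 * n), pow_mul]

lemma tsum_odd (q : ℂ) (hq : ‖q‖ < 1) :
    ∑' n : ℕ, lamb (q ^ (2 * n + 1)) = lambA q - lambA (q ^ 2) := by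
  have hq2 : ‖q ^ 2‖ < 1 := by
    rw [norm_pow]; exact pow_lt_one₀ (norm_nonneg _) hq two_ne_zero
  have e : ∀ k : ℕ, q ^ (2 * k + 1 + 1) = (q ^ 2) ^ (k + 1) := fun k => by
    rw [← pow_mul]; congr 1
  have := tsum_even_add_odd (f := fun n : ℕ => lamb (q ^ (n + 1))) (summable_odd q hq) (by
    simp only [e]; exact summable_lambA _ hq2)
  simp only [e] at this
  unfold lambA
  rw [← this]; ring

lemma tsum_neg_odd (q : ℂ) (hq : ‖q‖ < 1) :
    ∑' n : ℕ, lamb (-q ^ (2 * n + 1)) = 5 * lambA (q ^ 2) - 4 * lambA (q ^ 4) - lambA q := by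
  have hq2 : ‖q ^ 2‖ < 1 := by
    rw [norm_pow]; exact pow_lt_one₀ (norm_nonneg _) hq two_ne_zero
  have e : ∀ n : ℕ, lamb (-q ^ (2 * n + 1))
      = 4 * lamb ((q ^ 2) ^ (2 * n + 1)) - lamb (q ^ (2 * n + 1)) := fun n => by
    have := lamb_two (q ^ (2 * n + 1)) (fun h => by
      have h2 := congrArg norm h
      rw [norm_pow, norm_pow, ← pow_mul, norm_one] at h2
      exact absurd h2 (pow_lt_one₀ (norm_nonneg _) hq (by omega)).ne)
    rw [← pow_mul q 2, mul_comm 2 (2 * n + 1), pow_mul]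
    linear_combination this
  simp only [e]
  rw [((summable_odd _ hq2).mul_left 4).tsum_sub (summable_odd _ hq), tsum_mul_left,
    tsum_odd _ hq, tsum_odd _ hq2, ← pow_mul]
  ring

noncomputable def lambF (q x : ℂ) : ℂ := ∑' n : ℤ, lamb (x * q ^ n)

lemma lambF_shift (q x : ℂ) (hq0 : q ≠ 0) (k : ℕ) : lambF q (x * q ^ k) = lambF q x := by
  unfold lambF
  rw [← (Equiv.addRight (k : ℤ)).tsum_eq (fun n : ℤ => lamb (x * q ^ n))]
  refine tsum_congr fun n => ?_
  simp only [Equiv.coe_addRight]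
  rw [zpow_add₀ hq0, zpow_natCast]; congr 1; ring

lemma zpow_ne_one_aux (q : ℂ) (hq0 : q ≠ 0) (hq : ‖q‖ < 1) (n : ℤ) (hn : n ≠ 0) : ‖q ^ n‖ ≠ 1 := by
  rw [norm_zpow]
  intro h
  exact hn ((zpow_eq_one_iff_right₀ (norm_nonneg q) hq.ne).1 h)

lemma F_even (q w : ℂ) (hq0 : q ≠ 0) (hq : ‖q‖ < 1) (hw : w ^ 2 - w + 1 = 0) :
    lambF q w + lambF q (w ^ 2) + lambF q (w ^ 3) + lambF q (w ^ 4) + lambF q (w ^ 5)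
      = -35 / 12 + 2 * (36 * lambA (q ^ 6) - lambA q) := by
  have S := fun x => summable_lamb_int q x hq
  have hq6 : ‖q ^ 6‖ < 1 := by
    rw [norm_pow]; exact pow_lt_one₀ (norm_nonneg _) hq (by norm_num)
  unfold lambF
  rw [← (S _).tsum_add (S _), ← ((S _).add (S _)).tsum_add (S _),
    ← (((S _).add (S _)).add (S _)).tsum_add (S _),
    ← ((((S _).add (S _)).add (S _)).add (S _)).tsum_add (S _)]
  have key : ∀ n : ℤ, n ≠ 0 → lamb (w * q ^ n) + lamb (w ^ 2 * q ^ n) + lamb (w ^ 3 * q ^ n)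
      + lamb (w ^ 4 * q ^ n) + lamb (w ^ 5 * q ^ n)
      = 36 * lamb ((q ^ 6) ^ n) - lamb (q ^ n) := fun n hn => by
    have e : (q ^ n) ^ 6 = (q ^ 6) ^ n := by
      rw [← zpow_natCast, ← zpow_natCast, ← zpow_mul, ← zpow_mul, mul_comm]
    have := lamb_six w (q ^ n) hw (fun h => by
      have h2 := congrArg norm h
      rw [e, norm_one] at h2
      exact zpow_ne_one_aux (q ^ 6) (pow_ne_zero _ hq0) hq6 n hn h2)
    rw [e] at this
    linear_combination this
  have e1 : ∀ n : ℕ, lamb (w * q ^ ((n : ℤ) + 1)) + lamb (w ^ 2 * q ^ ((n : ℤ) + 1))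
      + lamb (w ^ 3 * q ^ ((n : ℤ) + 1))
      + lamb (w ^ 4 * q ^ ((n : ℤ) + 1)) + lamb (w ^ 5 * q ^ ((n : ℤ) + 1))
      = 36 * lamb ((q ^ 6) ^ (n + 1)) - lamb (q ^ (n + 1)) := fun n => by
    rw [key _ (by omega)]; norm_cast
  have e2 : ∀ n : ℕ, lamb (w * q ^ (-((n : ℤ) + 1))) + lamb (w ^ 2 * q ^ (-((n : ℤ) + 1)))
      + lamb (w ^ 3 * q ^ (-((n : ℤ) + 1)))
      + lamb (w ^ 4 * q ^ (-((n : ℤ) + 1))) + lamb (w ^ 5 * q ^ (-((n : ℤ) + 1)))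
      = 36 * lamb ((q ^ 6) ^ (n + 1)) - lamb (q ^ (n + 1)) := fun n => by
    rw [key _ (by omega), zpow_neg, zpow_neg, lamb_inv, lamb_inv]; norm_cast
  have hS := ((summable_lambA _ hq6).mul_left 36).sub (summable_lambA _ hq)
  rw [tsum_of_add_one_of_neg_add_one]
  · simp only [e1, e2]
    rw [((summable_lambA _ hq6).mul_left 36).tsum_sub (summable_lambA _ hq), tsum_mul_left]
    have := lamb_six_one w hw
    simp only [zpow_zero, mul_one]
    unfold lambA
    linear_combination this
  · simp only [e1]; exact hS
  · simp only [e2]; exact hS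

lemma F_odd (q w y : ℂ) (hq0 : q ≠ 0) (hq : ‖q‖ < 1) (hw : w ^ 2 - w + 1 = 0)
    (hy : y ^ 6 = -q ^ 3) :
    lambF q y + lambF q (w * y) + lambF q (w ^ 2 * y) + lambF q (w ^ 3 * y)
      + lambF q (w ^ 4 * y) + lambF q (w ^ 5 * y)
      = 72 * (5 * lambA (q ^ 6) - 4 * lambA (q ^ 12) - lambA (q ^ 3)) := by
  have S := fun x => summable_lamb_int q x hq
  have hq3 : ‖q ^ 3‖ < 1 := by
    rw [norm_pow]; exact pow_lt_one₀ (norm_nonneg _) hq (by norm_num)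
  unfold lambF
  rw [← (S _).tsum_add (S _), ← ((S _).add (S _)).tsum_add (S _),
    ← (((S _).add (S _)).add (S _)).tsum_add (S _),
    ← ((((S _).add (S _)).add (S _)).add (S _)).tsum_add (S _),
    ← (((((S _).add (S _)).add (S _)).add (S _)).add (S _)).tsum_add (S _)]
  have key : ∀ n : ℤ, lamb (y * q ^ n) + lamb (w * y * q ^ n) + lamb (w ^ 2 * y * q ^ n)
      + lamb (w ^ 3 * y * q ^ n)
      + lamb (w ^ 4 * y * q ^ n) + lamb (w ^ 5 * y * q ^ n)
      = 36 * lamb (-(q ^ 3) ^ (2 * n + 1)) := fun n => by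
    have e : (y * q ^ n) ^ 6 = -(q ^ 3) ^ (2 * n + 1) := by
      rw [mul_pow, hy, zpow_add₀ (pow_ne_zero _ hq0), zpow_mul, ← zpow_natCast (q ^ n),
        ← zpow_mul, mul_comm n, zpow_mul, zpow_one, zpow_natCast, zpow_ofNat, ← pow_mul]
      ring
    have := lamb_six w (y * q ^ n) hw (fun h => by
      have h2 := congrArg norm h
      rw [e, norm_one, norm_neg] at h2
      exact zpow_ne_one_aux (q ^ 3) (pow_ne_zero _ hq0) hq3 _ (by omega) h2)
    rw [e] at this
    simp only [mul_assoc] at this ⊢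
    linear_combination this
  simp only [key]
  have e1 : ∀ n : ℕ, 36 * lamb (-(q ^ 3) ^ (2 * (n : ℤ) + 1))
      = 36 * lamb (-(q ^ 3) ^ (2 * n + 1)) := fun n => by norm_cast
  have e2 : ∀ n : ℕ, 36 * lamb (-(q ^ 3) ^ (2 * (-((n : ℤ) + 1)) + 1))
      = 36 * lamb (-(q ^ 3) ^ (2 * n + 1)) := fun n => by
    rw [show 2 * (-((n : ℤ) + 1)) + 1 = -(2 * n + 1) by ring, zpow_neg, ← inv_neg, lamb_inv]
    norm_cast
  have hS : Summable fun n : ℕ => 36 * lamb (-(q ^ 3) ^ (2 * n + 1)) := by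
    have := summable_lamb_nat ((q ^ 3) ^ 2) (-q ^ 3) (by
      rw [norm_pow]; exact pow_lt_one₀ (norm_nonneg _) hq3 two_ne_zero)
    exact (this.mul_left 36).congr fun n => by
      rw [pow_succ' (q ^ 3) (2 * n), pow_mul (q ^ 3), neg_mul]
  rw [tsum_of_nat_of_neg_add_one]
  · simp only [e1, e2]
    rw [tsum_mul_left, tsum_neg_odd _ hq3, ← pow_mul, ← pow_mul]
    ring
  · simp only [e1]; exact hS
  · simp only [e2]; exact hS

/-- the q-expansion identity for the weight-2 form `A_{β₄₈}` attached
to the matrix `β₄₈ = [[−6,1],[−48,6]]` inducing the hyperelliptic involution of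
`X₀(48)`, evaluated on the Tate curve.  For `0 < |q| < 1`, `s² = q` and `ζ` a
primitive 12th root of unity, the double series
`∑_{j=1}^{11} ∑_{n∈ℤ} (s^j ζ^j q^n)/(1 − s^j ζ^j q^n)²` converges absolutely
(all denominators being nonzero), and
`−22·Ê₂(q) + ∑_{j=1}^{11} ∑_{n∈ℤ} (s^j ζ^j q^n)/(1 − s^j ζ^j q^n)²
  = 24·(Ê₂⁽³⁾(q) − 3·Ê₂⁽⁶⁾(q) + Ê₂⁽¹²⁾(q))`. -/
theorem stmt15 (q s ζ : ℂ) (hq0 : q ≠ 0) (hq : ‖q‖ < 1) (hs : s ^ 2 = q)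
    (hζ : IsPrimitiveRoot ζ 12) :
    (∀ j ∈ Finset.Ico 1 12, ∀ n : ℤ, 1 - s ^ j * ζ ^ j * q ^ n ≠ 0) ∧
    (∀ j ∈ Finset.Ico 1 12, Summable fun n : ℤ =>
      ‖s ^ j * ζ ^ j * q ^ n / (1 - s ^ j * ζ ^ j * q ^ n) ^ 2‖) ∧
    -22 * E2 q + ∑ j ∈ Finset.Ico 1 12, ∑' n : ℤ,
        s ^ j * ζ ^ j * q ^ n / (1 - s ^ j * ζ ^ j * q ^ n) ^ 2 =
      24 * (E2d 3 q - 3 * E2d 6 q + E2d 12 q) := by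
  refine ⟨?_, ?_, ?_⟩
  · intro j hj n h
    rw [Finset.mem_Ico] at hj
    have hs0 : s ≠ 0 := by rintro rfl; simp at hs; exact hq0 hs.symm
    have hs1 : ‖s‖ < 1 := by
      have : ‖s‖ ^ 2 < 1 := by rw [← norm_pow, hs]; exact hq
      exact (pow_lt_one_iff_of_nonneg (norm_nonneg _) two_ne_zero).1 this
    have h1 : s ^ j * ζ ^ j * q ^ n = 1 := (sub_eq_zero.1 h).symm
    have e : s ^ j * ζ ^ j * q ^ n = s ^ ((j : ℤ) + 2 * n) * ζ ^ j := by
      rw [zpow_add₀ hs0, zpow_mul, ← hs, zpow_natCast, zpow_ofNat]; ring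
    rw [e] at h1
    have hz : ‖ζ‖ = 1 := hζ.norm'_eq_one (by norm_num)
    have h2 : (j : ℤ) + 2 * n = 0 := by
      by_contra hne
      apply zpow_ne_one_aux s hs0 hs1 _ hne
      have := congrArg norm h1
      simpa [hz] using this
    rw [h2, zpow_zero, one_mul] at h1
    exact absurd (Nat.le_of_dvd (by omega) (hζ.dvd_of_pow_eq_one j h1)) (by omega)
  · intro j _
    exact (summable_lamb_int q (s ^ j * ζ ^ j) hq).norm
  · have hz6 : ζ ^ 6 = -1 := by
      have h12 := hζ.pow_eq_one
      have h6 : ζ ^ 6 ≠ 1 := hζ.pow_ne_one_of_pos_of_lt (by norm_num) (by norm_num)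
      have : (ζ ^ 6 - 1) * (ζ ^ 6 + 1) = 0 := by linear_combination h12
      rcases mul_eq_zero.1 this with h | h
      · exact absurd (sub_eq_zero.1 h) h6
      · linear_combination h
    have hw : (ζ ^ 2) ^ 2 - ζ ^ 2 + 1 = 0 := by
      have h4 : ζ ^ 4 ≠ 1 := hζ.pow_ne_one_of_pos_of_lt (by norm_num) (by norm_num)
      have : (ζ ^ 2 + 1) * ((ζ ^ 2) ^ 2 - ζ ^ 2 + 1) = 0 := by linear_combination hz6
      rcases mul_eq_zero.1 this with h | h
      · exact absurd (by linear_combination (ζ ^ 2 - 1) * h) h4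
      · exact h
    have hE := F_even q (ζ ^ 2) hq0 hq hw
    have hO := F_odd q (ζ ^ 2) (s * ζ) hq0 hq hw (by
      rw [mul_pow, hz6, show s ^ 6 = (s ^ 2) ^ 3 by ring, hs]; ring)
    have hpow : ∀ d : ℕ, d ≠ 0 → ‖q ^ d‖ < 1 := fun d hd => by
      rw [norm_pow]; exact pow_lt_one₀ (norm_nonneg _) hq hd
    have ev : ∀ k : ℕ, lambF q (s ^ (2 * k) * ζ ^ (2 * k)) = lambF q ((ζ ^ 2) ^ k) := fun k => by
      rw [← lambF_shift q ((ζ ^ 2) ^ k) hq0 k, pow_mul, pow_mul, hs, mul_comm]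
    have od : ∀ k : ℕ, lambF q (s ^ (2 * k + 1) * ζ ^ (2 * k + 1))
        = lambF q ((ζ ^ 2) ^ k * (s * ζ)) := fun k => by
      rw [← lambF_shift q ((ζ ^ 2) ^ k * (s * ζ)) hq0 k, pow_succ, pow_succ, pow_mul, pow_mul, hs]
      congr 1; ring
    have hsum : ∑ j ∈ Finset.Ico 1 12, ∑' n : ℤ,
        s ^ j * ζ ^ j * q ^ n / (1 - s ^ j * ζ ^ j * q ^ n) ^ 2
        = ∑ j ∈ Finset.Ico 1 12, lambF q (s ^ j * ζ ^ j) := rfl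
    rw [hsum]
    have hexp : ∑ j ∈ Finset.Ico 1 12, lambF q (s ^ j * ζ ^ j)
        = (lambF q (ζ ^ 2) + lambF q ((ζ ^ 2) ^ 2) + lambF q ((ζ ^ 2) ^ 3) + lambF q ((ζ ^ 2) ^ 4)
          + lambF q ((ζ ^ 2) ^ 5)) +
          (lambF q (s * ζ) + lambF q (ζ ^ 2 * (s * ζ)) + lambF q ((ζ ^ 2) ^ 2 * (s * ζ))
          + lambF q ((ζ ^ 2) ^ 3 * (s * ζ))
          + lambF q ((ζ ^ 2) ^ 4 * (s * ζ)) + lambF q ((ζ ^ 2) ^ 5 * (s * ζ))) := by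
      have v1 := ev 1
      have v2 := ev 2
      have v3 := ev 3
      have v4 := ev 4
      have v5 := ev 5
      have o0 := od 0
      have o1 := od 1
      have o2 := od 2
      have o3 := od 3
      have o4 := od 4
      have o5 := od 5
      norm_num only [pow_zero, one_mul, pow_one] at v1 v2 v3 v4 v5 o0 o1 o2 o3 o4 o5
      simp only [Finset.sum_Ico_succ_top, Nat.reduceLeDiff, Finset.Ico_self, Finset.sum_empty,
        pow_one, zero_add, v1, v2, v3, v4, v5, o1, o2, o3, o4, o5]
      ring
    rw [hexp, hE, hO]
    unfold E2d
    rw [E2_eq _ hq, E2_eq _ (hpow 3 (by norm_num)), E2_eq _ (hpow 6 (by norm_num)),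
      E2_eq _ (hpow 12 (by norm_num))]
    push_cast
    ring
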